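/- Define d_n := b_{n,+} + b_{n,−} ∈ TL(B_n) (the type D Jones–Wenzl projector). Then d_2 = 1 − δ^{−1}U_1 − δ^{−1}s_0U_1s_0 in TL(B_2), and for every n ≥ 2 the recursion d_{n+1} = ι_{n,n+1}(d_n) − ((q^{n−1} + q^{−(n−1)})/(q^{n} + q^{−n})) · ι_{n,n+1}(d_n) · U_n · ι_{n,n+1}(d_n) holds in TL(B_{n+1}). -/

import Mathlib

noncomputable section

/-- The ground field `K = ℂ(q)`, the complex rational functions. -/
abbrev K : Type := RatFunc ℂ

/-- The variable `q ∈ K = ℂ(q)`. -/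
noncomputable def q : K := RatFunc.X

/-- `δ = q + q⁻¹ ∈ K`. -/
noncomputable def δ : K := q + q⁻¹

/-- Defining relations of the type `B` Temperley–Lieb algebra `TL(Bₙ)` (over `K`, with
`δ = q + q⁻¹`): the generator of index `0` is `s₀` and the generator of index `i`
(for `1 ≤ i ≤ n-1`) is `Uᵢ`.  The relations are `Uᵢ² = δUᵢ`, `UᵢU_{i+1}Uᵢ = Uᵢ`,
`U_{i+1}UᵢU_{i+1} = U_{i+1}`, `UᵢUⱼ = UⱼUᵢ` for `|i-j| ≥ 2`, `s₀² = 1`, `U₁s₀U₁ = 0` and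
`s₀Uᵢ = Uᵢs₀` for `i ≥ 2`. -/
inductive TLBRel (n : ℕ) : FreeAlgebra K (Fin n) → FreeAlgebra K (Fin n) → Prop
  | Usq (i : Fin n) (hi : 1 ≤ (i : ℕ)) :
      TLBRel n (FreeAlgebra.ι K i * FreeAlgebra.ι K i) (δ • FreeAlgebra.ι K i)
  | braid₁ (i j : Fin n) (hi : 1 ≤ (i : ℕ)) (hj : (j : ℕ) = (i : ℕ) + 1) :
      TLBRel n (FreeAlgebra.ι K i * FreeAlgebra.ι K j * FreeAlgebra.ι K i) (FreeAlgebra.ι K i)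
  | braid₂ (i j : Fin n) (hi : 1 ≤ (i : ℕ)) (hj : (j : ℕ) = (i : ℕ) + 1) :
      TLBRel n (FreeAlgebra.ι K j * FreeAlgebra.ι K i * FreeAlgebra.ι K j) (FreeAlgebra.ι K j)
  | Ucomm (i j : Fin n) (hi : 1 ≤ (i : ℕ)) (h : (i : ℕ) + 2 ≤ (j : ℕ)) :
      TLBRel n (FreeAlgebra.ι K i * FreeAlgebra.ι K j) (FreeAlgebra.ι K j * FreeAlgebra.ι K i)
  | s0sq (i : Fin n) (hi : (i : ℕ) = 0) : TLBRel n (FreeAlgebra.ι K i * FreeAlgebra.ι K i) 1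
  | UsU (i j : Fin n) (hi : (i : ℕ) = 0) (hj : (j : ℕ) = 1) :
      TLBRel n (FreeAlgebra.ι K j * FreeAlgebra.ι K i * FreeAlgebra.ι K j) 0
  | s0comm (i j : Fin n) (hi : (i : ℕ) = 0) (h : 2 ≤ (j : ℕ)) :
      TLBRel n (FreeAlgebra.ι K i * FreeAlgebra.ι K j) (FreeAlgebra.ι K j * FreeAlgebra.ι K i)

/-- The type `B` Temperley–Lieb algebra `TL(Bₙ)` over `K = ℂ(q)` with `δ = q + q⁻¹`. -/
abbrev TLB (n : ℕ) := RingQuot (TLBRel n)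

/-- The generator of `TL(Bₙ)` with index `i`: `g n 0 = s₀`, and `g n i = Uᵢ` for
`1 ≤ i ≤ n-1` (indices out of range are sent to `0`). -/
noncomputable def g (n : ℕ) (i : ℕ) : TLB n :=
  if h : i < n then RingQuot.mkAlgHom K (TLBRel n) (FreeAlgebra.ι K ⟨i, h⟩) else 0

/-- `IsJW n ε b` says that `b` is a type `B` Jones–Wenzl projector of sign `ε` in `TL(Bₙ)`:
`b` is a nonzero idempotent with `s₀·b = ε·b = b·s₀` and `Uᵢ·b = 0 = b·Uᵢ` for all
`1 ≤ i ≤ n-1`.  For `ε = 1` this characterizes `b_{n,+}` and for `ε = -1` it characterizes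
`b_{n,-}`. -/
def IsJW (n : ℕ) (ε : K) (b : TLB n) : Prop :=
  b ≠ 0 ∧ b * b = b ∧ g n 0 * b = ε • b ∧ b * g n 0 = ε • b ∧
    ∀ i : ℕ, 1 ≤ i → i ≤ n - 1 → g n i * b = 0 ∧ b * g n i = 0

/-- The quantum-integer-like quantity `qⁿ + q⁻ⁿ`. -/
def qsum (n : ℤ) : K := q ^ n + q ^ (-n)

theorem q_ne_zero : q ≠ 0 := RatFunc.X_ne_zero

theorem q_pow_add_one_ne_zero (n : ℕ) : q ^ n + 1 ≠ 0 := by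
  have h : (Polynomial.X ^ n + 1 : Polynomial ℂ) ≠ 0 := by
    intro h
    have h' := congrArg (Polynomial.eval 1) h
    norm_num at h'
  intro h'
  apply h
  apply RatFunc.algebraMap_injective ℂ
  simpa [q] using h'

theorem qsum_ne_zero (n : ℕ) : qsum n ≠ 0 := by
  intro h
  apply q_pow_add_one_ne_zero (2 * n)
  have hq : q ^ n ≠ 0 := pow_ne_zero _ q_ne_zero
  simp only [qsum, zpow_neg, zpow_natCast] at h
  have h' := congrArg (q ^ n * ·) h
  simp only [mul_add, mul_inv_cancel₀ hq, mul_zero] at h'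
  rw [two_mul, pow_add]
  exact h'

theorem qsum_one : qsum 1 = δ := by simp [qsum, δ]

theorem δ_ne_zero : δ ≠ 0 := by simpa [qsum_one] using qsum_ne_zero 1

theorem δ_mul_qsum (n : ℤ) : δ * qsum n = qsum (n + 1) + qsum (n - 1) := by
  have hq := q_ne_zero
  simp only [qsum, δ, neg_add, neg_sub, zpow_add₀ hq, zpow_sub₀ hq, zpow_neg, zpow_one]
  field_simp
  ring

/-- The coefficient in the recursion for the type `D` Jones–Wenzl projectors. -/
def jwCoeff (n : ℕ) : K := qsum ((n : ℤ) - 1) / qsum n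

theorem jwCoeff_succ_ne_zero (n : ℕ) : jwCoeff (n + 1) ≠ 0 := by
  have h := div_ne_zero (qsum_ne_zero n) (qsum_ne_zero (n + 1))
  simpa [jwCoeff] using h

theorem δ_sub_jwCoeff (n : ℕ) : δ - jwCoeff n = (jwCoeff (n + 1))⁻¹ := by
  have h := δ_mul_qsum n
  have hn := qsum_ne_zero n
  simp only [jwCoeff, Nat.cast_add, Nat.cast_one, add_sub_cancel_right, inv_div]
  field_simp
  linear_combination h

theorem inv_jwCoeff_two : (jwCoeff 2)⁻¹ = δ - δ⁻¹ - δ⁻¹ := by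
  rw [← δ_sub_jwCoeff 1]
  have h0 : qsum 0 = 2 := by norm_num [qsum]
  simp only [jwCoeff, Nat.cast_one, sub_self, h0, qsum_one]
  ring

section Relations

variable {N : ℕ}

theorem g_of_lt {i : ℕ} (h : i < N) :
    g N i = RingQuot.mkAlgHom K (TLBRel N) (FreeAlgebra.ι K ⟨i, h⟩) := dif_pos h

theorem g_of_le {i : ℕ} (h : N ≤ i) : g N i = 0 := dif_neg h.not_gt

theorem g_mul_self {i : ℕ} (hi : 1 ≤ i) : g N i * g N i = δ • g N i := by
  by_cases h : i < N
  · simpa [g_of_lt h] using RingQuot.mkAlgHom_rel K (TLBRel.Usq ⟨i, h⟩ hi)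
  · simp [g_of_le (not_lt.mp h)]

theorem g_mul_succ_mul {i : ℕ} (hi : 1 ≤ i) (h : i + 1 < N) :
    g N i * g N (i + 1) * g N i = g N i := by
  have h' : i < N := by lia
  simpa [g_of_lt h, g_of_lt h'] using
    RingQuot.mkAlgHom_rel K (TLBRel.braid₁ ⟨i, h'⟩ ⟨i + 1, h⟩ hi rfl)

theorem g_succ_mul_mul {i : ℕ} (hi : 1 ≤ i) (h : i + 1 < N) :
    g N (i + 1) * g N i * g N (i + 1) = g N (i + 1) := by
  have h' : i < N := by lia
  simpa [g_of_lt h, g_of_lt h'] using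
    RingQuot.mkAlgHom_rel K (TLBRel.braid₂ ⟨i, h'⟩ ⟨i + 1, h⟩ hi rfl)

theorem commute_g {i j : ℕ} (h : i + 2 ≤ j) : Commute (g N i) (g N j) := by
  by_cases hj : j < N
  · have hi : i < N := by lia
    rw [g_of_lt hi, g_of_lt hj, commute_iff_eq, ← map_mul, ← map_mul]
    rcases Nat.eq_zero_or_pos i with h0 | h0
    · exact RingQuot.mkAlgHom_rel K (TLBRel.s0comm ⟨i, hi⟩ ⟨j, hj⟩ h0 (by simp; lia))
    · exact RingQuot.mkAlgHom_rel K (TLBRel.Ucomm ⟨i, hi⟩ ⟨j, hj⟩ h0 h)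
  · rw [g_of_le (not_lt.mp hj)]
    exact Commute.zero_right _

theorem g_zero_mul_self (h : 0 < N) : g N 0 * g N 0 = 1 := by
  simpa [g_of_lt h] using RingQuot.mkAlgHom_rel K (TLBRel.s0sq ⟨0, h⟩ rfl)

theorem g_one_mul_zero_mul_one : g N 1 * g N 0 * g N 1 = 0 := by
  by_cases h : 1 < N
  · have h0 : 0 < N := by lia
    simpa [g_of_lt h, g_of_lt h0] using
      RingQuot.mkAlgHom_rel K (TLBRel.UsU ⟨0, h0⟩ ⟨1, h⟩ rfl rfl)
  · simp [g_of_le (not_lt.mp h)]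

theorem TLB.sub_smul (a b : K) (x : TLB N) : (a - b) • x = a • x - b • x := by
  rw [eq_sub_iff_add_eq, ← add_smul, sub_add_cancel]

/-- Induction principle: `TL(Bₙ)` is generated as an algebra by the `g n i`. -/
theorem TLB.induction {P : TLB N → Prop} (hc : ∀ r : K, P (algebraMap K _ r))
    (hg : ∀ i < N, P (g N i)) (hmul : ∀ x y, P x → P y → P (x * y))
    (hadd : ∀ x y, P x → P y → P (x + y)) (x : TLB N) : P x := by
  obtain ⟨a, rfl⟩ := RingQuot.mkAlgHom_surjective K (TLBRel N) x
  induction a using FreeAlgebra.induction with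
  | grade0 r => simpa using hc r
  | grade1 i => simpa [g_of_lt i.2] using hg i i.2
  | mul a b ha hb => simpa using hmul _ _ ha hb
  | add a b ha hb => simpa using hadd _ _ ha hb

/-- The inclusion `TL(Bₙ) → TL(B_{n+1})`. -/
theorem exists_inclusion (n : ℕ) :
    ∃ ι : TLB n →ₐ[K] TLB (n + 1), ∀ i : ℕ, i < n → ι (g n i) = g (n + 1) i := by
  refine ⟨RingQuot.liftAlgHom K ⟨FreeAlgebra.lift K fun i : Fin n => g (n + 1) i, ?_⟩, ?_⟩
  · intro x y hxy
    induction hxy with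
    | Usq i hi => simpa using g_mul_self hi
    | braid₁ i j hi hj => simpa [hj] using g_mul_succ_mul hi (by lia)
    | braid₂ i j hi hj => simpa [hj] using g_succ_mul_mul hi (by lia)
    | Ucomm i j hi h => simpa using (commute_g h).eq
    | s0sq i hi => simpa [hi] using g_zero_mul_self (Nat.succ_pos n)
    | UsU i j hi hj => simpa [hi, hj] using g_one_mul_zero_mul_one
    | s0comm i j hi h => simpa using (commute_g (by lia)).eq
  · intro i hi
    simp [g_of_lt hi]

end Relations

/-- The type `D` Jones–Wenzl element on the first `k` strands, as an element of `TL(B_N)`. -/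
def jwD (N : ℕ) : ℕ → TLB N
  | 0 => 1
  | 1 => 1
  | 2 => 1 - δ⁻¹ • g N 1 - δ⁻¹ • (g N 0 * g N 1 * g N 0)
  | k + 3 => jwD N (k + 2) - jwCoeff (k + 2) • (jwD N (k + 2) * g N (k + 2) * jwD N (k + 2))

theorem jwD_succ (N : ℕ) {k : ℕ} (hk : 2 ≤ k) :
    jwD N (k + 1) = jwD N k - jwCoeff k • (jwD N k * g N k * jwD N k) := by
  obtain ⟨k, rfl⟩ := Nat.exists_eq_add_of_le' hk
  rfl

/-- An element commuting with all generators occurring in `jwD N k` commutes with `jwD N k`. -/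
theorem commute_jwD {N : ℕ} {x : TLB N} (k : ℕ) (h : ∀ i < k, Commute x (g N i)) :
    Commute x (jwD N k) := by
  match k with
  | 0 => exact Commute.one_right x
  | 1 => exact Commute.one_right x
  | 2 =>
    have h0 := h 0 (by lia)
    have h1 := h 1 (by lia)
    exact ((Commute.one_right x).sub_right (h1.smul_right _)).sub_right
      (((h0.mul_right h1).mul_right h0).smul_right _)
  | k + 3 =>
    have hk := commute_jwD (k + 2) fun i hi => h i (by lia)
    exact hk.sub_right (((hk.mul_right (h _ (by lia))).mul_right hk).smul_right _)

theorem commute_g_jwD {N k j : ℕ} (h : k + 1 ≤ j) : Commute (g N j) (jwD N k) :=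
  commute_jwD k fun _ hi => (commute_g (by lia)).symm

theorem map_jwD {n N : ℕ} (f : TLB n →ₐ[K] TLB N) (k : ℕ)
    (hf : ∀ i < k, f (g n i) = g N i) : f (jwD n k) = jwD N k := by
  match k with
  | 0 => exact map_one f
  | 1 => exact map_one f
  | 2 => simp [jwD, hf 0 (by lia), hf 1 (by lia)]
  | k + 3 => simp [jwD, map_jwD f (k + 2) fun i hi => hf i (by lia), hf (k + 2) (by lia)]

/-- The left-sided properties of the type `D` Jones–Wenzl projector on `k` strands, together with
the partial trace formula which drives the recursion. -/
structure IsJWD (N k : ℕ) : Prop where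
  commute_zero : Commute (g N 0) (jwD N k)
  g_mul : ∀ i, 1 ≤ i → i < k → g N i * jwD N k = 0
  mul_self : jwD N k * jwD N k = jwD N k
  pred_mul : jwD N (k - 1) * jwD N k = jwD N k
  trace : k < N → g N k * jwD N k * g N k = (jwCoeff k)⁻¹ • (jwD N (k - 1) * g N k)

theorem isJWD_two {N : ℕ} (hN : 2 ≤ N) : IsJWD N 2 := by
  have hδ := δ_ne_zero
  have hss : g N 0 * g N 0 = 1 := g_zero_mul_self (by lia)
  have hUU : g N 1 * g N 1 = δ • g N 1 := g_mul_self le_rfl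
  have hUsU : g N 1 * (g N 0 * g N 1) = 0 := by
    rw [← mul_assoc]
    exact g_one_mul_zero_mul_one
  have hs : ∀ x, g N 0 * (g N 0 * x) = x := fun x => by rw [← mul_assoc, hss, one_mul]
  have hUsU' : ∀ x, g N 1 * (g N 0 * (g N 1 * x)) = 0 := fun x => by
    rw [← mul_assoc (g N 0), ← mul_assoc, hUsU, zero_mul]
  have hl : g N 1 * jwD N 2 = 0 := by
    simp [jwD, mul_sub, mul_assoc, hUU, hUsU', smul_smul, hδ]
  have hc : Commute (g N 0) (jwD N 2) := by
    simp only [commute_iff_eq, jwD, mul_sub, sub_mul, mul_assoc, mul_smul_comm, smul_mul_assoc,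
      hss, hs, mul_one, one_mul]
    abel
  have hi : ∀ i, 1 ≤ i → i < 2 → i = 1 := fun i _ _ => by lia
  refine ⟨hc, fun i h h' => hi i h h' ▸ hl, ?_, by simp [jwD], fun h2 => ?_⟩
  · nth_rewrite 1 [jwD]
    simp only [sub_mul, one_mul, smul_mul_assoc, mul_assoc, hc.eq]
    simp [← mul_assoc (g N 1), hl]
  · have hb : g N 2 * g N 1 * g N 2 = g N 2 := g_succ_mul_mul le_rfl h2
    have h02 : g N 0 * g N 2 = g N 2 * g N 0 := (commute_g le_rfl).eq
    have hb' : g N 2 * (g N 0 * g N 1 * g N 0) * g N 2 = g N 2 := by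
      calc g N 2 * (g N 0 * g N 1 * g N 0) * g N 2
          = (g N 2 * g N 0) * (g N 1 * (g N 0 * g N 2)) := by simp only [mul_assoc]
        _ = (g N 0 * g N 2) * (g N 1 * (g N 2 * g N 0)) := by rw [h02]
        _ = g N 0 * (g N 2 * g N 1 * g N 2) * g N 0 := by simp only [mul_assoc]
        _ = g N 2 := by rw [hb, h02, mul_assoc, hss, mul_one]
    rw [inv_jwCoeff_two]
    simp only [jwD, Nat.add_one_sub_one, mul_sub, sub_mul, mul_one, one_mul, mul_smul_comm,
      smul_mul_assoc, hb, hb', g_mul_self one_le_two, TLB.sub_smul]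

theorem IsJWD.succ {N k : ℕ} (hk : 2 ≤ k) (hN : k < N) (h : IsJWD N k) : IsJWD N (k + 1) := by
  have hcoef : jwCoeff k ≠ 0 := by
    obtain ⟨m, rfl⟩ := Nat.exists_eq_add_of_le' hk
    exact jwCoeff_succ_ne_zero _
  have hD := jwD_succ N hk
  have hp : jwD N k * jwD N (k + 1) = jwD N (k + 1) := by
    simp only [hD, mul_sub, mul_smul_comm, ← mul_assoc, h.mul_self]
  have hcomm : Commute (g N k) (jwD N (k - 1)) := commute_g_jwD (by lia)
  have hl : g N k * jwD N (k + 1) = 0 := by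
    rw [hD, mul_sub, mul_smul_comm, ← mul_assoc, ← mul_assoc, h.trace hN, smul_mul_assoc,
      smul_smul, mul_inv_cancel₀ hcoef, one_smul, ← hcomm.eq, mul_assoc, h.pred_mul, sub_self]
  have h0 : Commute (g N 0) (jwD N (k + 1)) := by
    rw [hD]
    exact h.commute_zero.sub_right
      (((h.commute_zero.mul_right (commute_g (by lia))).mul_right h.commute_zero).smul_right _)
  refine ⟨h0, fun i hi hik => ?_, ?_, by simpa using hp, fun hN' => ?_⟩
  · rcases Nat.lt_succ_iff_lt_or_eq.mp hik with hik | rfl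
    · rw [← hp, ← mul_assoc, h.g_mul i hi hik, zero_mul]
    · exact hl
  · nth_rewrite 1 [hD]
    rw [sub_mul, smul_mul_assoc, hp, mul_assoc (jwD N k * g N k), hp, mul_assoc, hl, mul_zero,
      smul_zero, sub_zero]
  · have hc : g N (k + 1) * jwD N k = jwD N k * g N (k + 1) := (commute_g_jwD le_rfl).eq
    have hb : g N (k + 1) * g N k * g N (k + 1) = g N (k + 1) := g_succ_mul_mul (by lia) hN'
    have hmid : g N (k + 1) * (jwD N k * g N k * jwD N k) * g N (k + 1)
        = jwD N k * g N (k + 1) := by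
      calc g N (k + 1) * (jwD N k * g N k * jwD N k) * g N (k + 1)
          = (g N (k + 1) * jwD N k) * g N k * (jwD N k * g N (k + 1)) := by
            simp only [mul_assoc]
        _ = jwD N k * (g N (k + 1) * g N k * g N (k + 1)) * jwD N k := by
            rw [hc, ← hc]
            simp only [mul_assoc, hc]
        _ = jwD N k * g N (k + 1) := by rw [hb, mul_assoc, hc, ← mul_assoc, h.mul_self]
    rw [Nat.add_sub_cancel, ← δ_sub_jwCoeff, hD, mul_sub, sub_mul, mul_smul_comm, smul_mul_assoc,
      hmid, hc, mul_assoc, g_mul_self (by lia), mul_smul_comm, TLB.sub_smul]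

theorem isJWD {N k : ℕ} (hk : 2 ≤ k) (hN : k ≤ N) : IsJWD N k := by
  induction k, hk using Nat.le_induction with
  | base => exact isJWD_two hN
  | succ k hk ih => exact (ih (by lia)).succ hk (by lia)

/-- `TL(Bₙ)` acts through a common character on all elements `e` with `s₀e = εe` and
`Uᵢe = 0`. -/
theorem exists_scalar_mul {n : ℕ} (ε : K) (x : TLB n) : ∃ c : K, ∀ e : TLB n,
    g n 0 * e = ε • e → (∀ i, 1 ≤ i → i < n → g n i * e = 0) → x * e = c • e := by
  induction x using TLB.induction with
  | hc r => exact ⟨r, fun e _ _ => (Algebra.smul_def r e).symm⟩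
  | hg i hi =>
    rcases Nat.eq_zero_or_pos i with rfl | h0
    · exact ⟨ε, fun e he _ => he⟩
    · exact ⟨0, fun e _ he => by rw [he i h0 hi, zero_smul]⟩
  | hmul x y hx hy =>
    obtain ⟨c, hc⟩ := hx
    obtain ⟨d, hd⟩ := hy
    refine ⟨d * c, fun e h0 he => ?_⟩
    rw [mul_assoc, hd e h0 he, mul_smul_comm, hc e h0 he, smul_smul]
  | hadd x y hx hy =>
    obtain ⟨c, hc⟩ := hx
    obtain ⟨d, hd⟩ := hy
    exact ⟨c + d, fun e h0 he => by rw [add_mul, hc e h0 he, hd e h0 he, add_smul]⟩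

theorem IsJW.mul_eq_right {n : ℕ} {ε : K} {b e : TLB n} (hb : IsJW n ε b)
    (h0 : g n 0 * e = ε • e) (he : ∀ i, 1 ≤ i → i < n → g n i * e = 0) : b * e = e := by
  obtain ⟨hne, hid, hl, -, hU⟩ := hb
  obtain ⟨c, hc⟩ := exists_scalar_mul ε b
  have hcb := hc b hl fun i hi hin => (hU i hi (by lia)).1
  have hc1 : c = 1 := by
    have h : (c - 1) • b = 0 := by rw [TLB.sub_smul, one_smul, ← hcb, hid, sub_self]
    exact sub_eq_zero.mp ((smul_eq_zero.mp h).resolve_right hne)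
  rw [hc e h0 he, hc1, one_smul]

/-- A type `B` Jones–Wenzl projector absorbs `jwD n k`. -/
theorem IsJW.mul_jwD {n : ℕ} {ε : K} {b : TLB n} (hb : IsJW n ε b) (k : ℕ) (hk : k ≤ n) :
    b * jwD n k = b := by
  obtain ⟨-, -, -, hr, hU⟩ := id hb
  match k with
  | 0 => exact mul_one b
  | 1 => exact mul_one b
  | 2 =>
    have h1 : b * g n 1 = 0 := (hU 1 le_rfl (by lia)).2
    simp [jwD, mul_sub, ← mul_assoc, hr, h1]
  | k + 3 =>
    have ih := hb.mul_jwD (k + 2) (by lia)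
    have h1 : b * g n (k + 2) = 0 := (hU _ (by lia) (by lia)).2
    simp [jwD, mul_sub, ← mul_assoc, ih, h1]

theorem IsJW.eq_smul_jwD {n : ℕ} (hn : 2 ≤ n) {ε : K} (hε : ε * ε = 1) {b : TLB n}
    (hb : IsJW n ε b) : b = (2⁻¹ : K) • ((1 + ε • g n 0) * jwD n n) := by
  have h := isJWD hn le_rfl
  have hss : g n 0 * g n 0 = 1 := g_zero_mul_self (by lia)
  rw [← hb.mul_eq_right (e := (2⁻¹ : K) • ((1 + ε • g n 0) * jwD n n))]
  · obtain ⟨-, -, -, hr, -⟩ := id hb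
    rw [mul_smul_comm, ← mul_assoc, mul_add, mul_one, mul_smul_comm, hr, smul_smul, hε, one_smul,
      add_mul, hb.mul_jwD n le_rfl, ← two_smul K b, smul_smul, inv_mul_cancel₀ two_ne_zero,
      one_smul]
  · have hs : g n 0 * (1 + ε • g n 0) = ε • (1 + ε • g n 0) := by
      rw [mul_add, mul_smul_comm, hss, mul_one, smul_add, smul_smul, hε, one_smul, add_comm]
    rw [mul_smul_comm, smul_comm ε, ← mul_assoc, hs, smul_mul_assoc]
  · intro i hi hin
    rw [add_mul, smul_mul_assoc, one_mul, h.commute_zero.eq, mul_smul_comm, mul_add,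
      mul_smul_comm, ← mul_assoc, h.g_mul i hi hin, zero_mul, smul_zero, add_zero, smul_zero]

/-- The sum of the two type `B` Jones–Wenzl projectors is `jwD n n`. -/
theorem IsJW.add_eq_jwD {n : ℕ} (hn : 2 ≤ n) {bp bm : TLB n} (hp : IsJW n 1 bp)
    (hm : IsJW n (-1) bm) : bp + bm = jwD n n := by
  have hneg : (-1 : K) • g n 0 = -g n 0 := by
    rw [eq_neg_iff_add_eq_zero]
    nth_rewrite 2 [← one_smul K (g n 0)]
    rw [← add_smul, neg_add_cancel, zero_smul]
  rw [hp.eq_smul_jwD hn (by norm_num), hm.eq_smul_jwD hn (by norm_num), ← smul_add, ← add_mul,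
    one_smul, hneg, add_add_add_comm, add_neg_cancel, add_zero, add_mul, one_mul,
    ← two_smul K (jwD n n), smul_smul, inv_mul_cancel₀ two_ne_zero, one_smul]

/-- With `dₙ := b_{n,+} + b_{n,-} ∈ TL(Bₙ)` (the type `D` Jones–Wenzl
projector): `d₂ = 1 - δ⁻¹U₁ - δ⁻¹s₀U₁s₀` in `TL(B₂)`, and for every `n ≥ 2`, for the
canonical inclusion `ι = ι_{n,n+1} : TL(Bₙ) → TL(B_{n+1})` (sending each generator to the
generator of the same index), one has the recursion
`d_{n+1} = ι(dₙ) - ((q^{n-1} + q^{-(n-1)})/(qⁿ + q^{-n}))·ι(dₙ)·Uₙ·ι(dₙ)` in `TL(B_{n+1})`. -/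
theorem stmt_16 :
    (∀ bp bm : TLB 2, IsJW 2 1 bp → IsJW 2 (-1) bm →
      bp + bm = 1 - δ⁻¹ • g 2 1 - δ⁻¹ • (g 2 0 * g 2 1 * g 2 0)) ∧
    ∀ n : ℕ, 2 ≤ n →
      (∃ ι : TLB n →ₐ[K] TLB (n + 1), ∀ i : ℕ, i < n → ι (g n i) = g (n + 1) i) ∧
      ∀ ι : TLB n →ₐ[K] TLB (n + 1), (∀ i : ℕ, i < n → ι (g n i) = g (n + 1) i) →
        ∀ bp bm : TLB n, ∀ bp' bm' : TLB (n + 1),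
          IsJW n 1 bp → IsJW n (-1) bm → IsJW (n + 1) 1 bp' → IsJW (n + 1) (-1) bm' →
            bp' + bm' = ι (bp + bm) -
              ((q ^ ((n : ℤ) - 1) + q ^ (-((n : ℤ) - 1))) / (q ^ (n : ℤ) + q ^ (-(n : ℤ)))) •
                (ι (bp + bm) * g (n + 1) n * ι (bp + bm)) := by
  refine ⟨fun bp bm hp hm => hp.add_eq_jwD le_rfl hm, fun n hn => ⟨exists_inclusion n, ?_⟩⟩
  intro ι hι bp bm bp' bm' hp hm hp' hm'
  rw [hp'.add_eq_jwD (by lia) hm', hp.add_eq_jwD hn hm, map_jwD ι n hι, jwD_succ _ hn]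
  rfl
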